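/- arXiv:2605.28776 — 2 statements merged into one kernel-verified Lean document; each statement's English description precedes it below -/
import Mathlib

section
/- Let β ∈ (0,1). Then there exist constants 0 < c ≤ C, depending only on β, such that for all integers n ≥ 3: if β > 1/2 then c ≤ F₃(3−3β, 1+β, 2β; n) ≤ C; if β = 1/2 then c · log n ≤ F₃(3−3β, 1+β, 2β; n) ≤ C · log n; and if β < 1/2 then c · n^{1−2β} ≤ F₃(3−3β, 1+β, 2β; n) ≤ C · n^{1−2β}. -/
open Real
open scoped Classical

/-- `F_k(a₁,…,a_k; n) = ∑_{1 ≤ i₁ < ⋯ < i_k ≤ n} ∏_j i_j^{-a_j}`, encoded as a sum over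
strictly monotone maps `Fin k → Fin n` (with `i_j = f j + 1 ∈ {1,…,n}`). -/
noncomputable def Fsum (k : ℕ) (a : Fin k → ℝ) (n : ℕ) : ℝ :=
  ∑ f ∈ Finset.univ.filter (fun f : Fin k → Fin n => StrictMono f),
    ∏ j : Fin k, (((f j : ℕ) : ℝ) + 1) ^ (-(a j))

/-- The truncated zeta sum `∑_{k=1}^n k^{-s}`. -/
noncomputable def truncatedZeta (s : ℝ) (n : ℕ) : ℝ :=
  ∑ k ∈ Finset.range n, ((k : ℝ) + 1) ^ (-s)

lemma truncatedZeta_nonneg (s : ℝ) (n : ℕ) : 0 ≤ truncatedZeta s n :=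
  Finset.sum_nonneg fun _ _ => by positivity

lemma one_le_truncatedZeta (s : ℝ) {n : ℕ} (hn : 1 ≤ n) : 1 ≤ truncatedZeta s n := by
  have h := Finset.single_le_sum (f := fun k : ℕ => ((k : ℝ) + 1) ^ (-s)) (s := Finset.range n)
    (fun _ _ => by positivity) (Finset.mem_range.2 hn)
  simpa [truncatedZeta] using h

lemma truncatedZeta_bounded {s : ℝ} (hs : 1 < s) : ∃ C : ℝ, 0 < C ∧ ∀ n, truncatedZeta s n ≤ C := by
  have h : Summable fun k : ℕ => ((k : ℝ) + 1) ^ (-s) := by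
    have h0 := (summable_nat_add_iff 1).2 (Real.summable_nat_rpow.2 (by linarith : -s < -1))
    simpa using h0
  have hC n : truncatedZeta s n ≤ ∑' k : ℕ, ((k : ℝ) + 1) ^ (-s) :=
    h.sum_le_tsum _ fun _ _ => by positivity
  exact ⟨_, one_pos.trans_le ((one_le_truncatedZeta s le_rfl).trans (hC 1)), hC⟩

lemma truncatedZeta_add_two_le {s : ℝ} (hs : 0 ≤ s) {m : ℕ} (hm : 1 ≤ m) :
    truncatedZeta s (m + 2) ≤ 3 * truncatedZeta s m := by
  have h1 := one_le_truncatedZeta s hm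
  have h (k : ℕ) : ((k : ℝ) + 1) ^ (-s) ≤ 1 :=
    Real.rpow_le_one_of_one_le_of_nonpos (by linarith [k.cast_nonneg (α := ℝ)]) (by linarith)
  have h2 := h m
  have h3 := h (m + 1)
  rw [truncatedZeta, Finset.sum_range_succ, Finset.sum_range_succ]
  change truncatedZeta s m + _ + _ ≤ _
  linarith

lemma truncatedZeta_one_eq_harmonic (n : ℕ) : truncatedZeta 1 n = (harmonic n : ℝ) := by
  simp [truncatedZeta, harmonic, Real.rpow_neg_one]

lemma one_le_log_of_three_le {n : ℕ} (hn : 3 ≤ n) : 1 ≤ Real.log n := by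
  rw [Real.le_log_iff_exp_le (by positivity)]
  have : (3 : ℝ) ≤ n := by exact_mod_cast hn
  linarith [Real.exp_one_lt_d9]

lemma rpow_le_truncatedZeta {s : ℝ} (hs : 0 ≤ s) {n : ℕ} (hn : 1 ≤ n) :
    (n : ℝ) ^ (1 - s) ≤ truncatedZeta s n := by
  have hn0 : (0 : ℝ) < n := by exact_mod_cast hn
  have h : ∑ _k ∈ Finset.range n, (n : ℝ) ^ (-s) ≤ truncatedZeta s n := by
    refine Finset.sum_le_sum fun k hk => ?_
    refine Real.rpow_le_rpow_of_nonpos (by positivity) ?_ (by linarith)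
    exact_mod_cast Finset.mem_range.1 hk
  rw [Finset.sum_const, Finset.card_range, nsmul_eq_mul] at h
  rwa [sub_eq_add_neg, Real.rpow_add hn0, Real.rpow_one]

lemma mul_rpow_le_rpow_sub_rpow {r : ℝ} (h0 : 0 ≤ r) (h1 : r ≤ 1) (k : ℕ) :
    r * ((k : ℝ) + 1) ^ (r - 1) ≤ ((k : ℝ) + 1) ^ r - (k : ℝ) ^ r := by
  have hk : (0 : ℝ) < (k : ℝ) + 1 := by positivity
  have hb : (-1 : ℝ) ≤ -(1 / ((k : ℝ) + 1)) := by
    rw [neg_le_neg_iff, div_le_one hk]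
    linarith [k.cast_nonneg (α := ℝ)]
  have h := rpow_one_add_le_one_add_mul_self hb h0 h1
  have hq : (k : ℝ) = ((k : ℝ) + 1) * (1 + -(1 / ((k : ℝ) + 1))) := by
    field_simp
    ring
  have hr : (k : ℝ) ^ r = ((k : ℝ) + 1) ^ r * (1 + -(1 / ((k : ℝ) + 1))) ^ r := by
    rw [← Real.mul_rpow hk.le (by linarith), ← hq]
  rw [hr, Real.rpow_sub hk, Real.rpow_one]
  have h2 := mul_le_mul_of_nonneg_left h (Real.rpow_nonneg hk.le r)
  calc r * (((k : ℝ) + 1) ^ r / ((k : ℝ) + 1))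
      = ((k : ℝ) + 1) ^ r - ((k : ℝ) + 1) ^ r * (1 + r * -(1 / ((k : ℝ) + 1))) := by
        field_simp
        ring
    _ ≤ _ := by linarith

lemma truncatedZeta_le_rpow {s : ℝ} (hs : 0 ≤ s) (hs1 : s < 1) (n : ℕ) :
    truncatedZeta s n ≤ (1 - s)⁻¹ * (n : ℝ) ^ (1 - s) := by
  have hr : 0 < 1 - s := by linarith
  rw [inv_mul_eq_div, le_div_iff₀' hr, truncatedZeta, Finset.mul_sum]
  have h : ∑ k ∈ Finset.range n, (1 - s) * ((k : ℝ) + 1) ^ (-s) ≤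
      ∑ k ∈ Finset.range n, (((k + 1 : ℕ) : ℝ) ^ (1 - s) - (k : ℝ) ^ (1 - s)) := by
    refine Finset.sum_le_sum fun k _ => ?_
    have h := mul_rpow_le_rpow_sub_rpow hr.le (by linarith) k
    rw [show 1 - s - 1 = -s by ring] at h
    exact_mod_cast h
  rw [Finset.sum_range_sub (fun k : ℕ => (k : ℝ) ^ (1 - s))] at h
  simpa [Real.zero_rpow hr.ne'] using h

/-- A pointwise bound on increasing tuples by a product of powers with other exponents
bounds `Fsum` by the product of the corresponding truncated zeta sums. -/
lemma Fsum_le_prod_truncatedZeta {k : ℕ} (a b : Fin k → ℝ) (n : ℕ)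
    (h : ∀ f : Fin k → Fin n, StrictMono f →
      ∏ j, (((f j : ℕ) : ℝ) + 1) ^ (-(a j)) ≤ ∏ j, (((f j : ℕ) : ℝ) + 1) ^ (-(b j))) :
    Fsum k a n ≤ ∏ j, truncatedZeta (b j) n := by
  calc Fsum k a n
      ≤ ∑ f ∈ Finset.univ.filter (fun f : Fin k → Fin n => StrictMono f),
          ∏ j, (((f j : ℕ) : ℝ) + 1) ^ (-(b j)) :=
        Finset.sum_le_sum fun f hf => h f (Finset.mem_filter.1 hf).2
    _ ≤ ∑ f : Fin k → Fin n, ∏ j, (((f j : ℕ) : ℝ) + 1) ^ (-(b j)) :=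
        Finset.sum_le_sum_of_subset_of_nonneg (Finset.filter_subset _ _)
          fun _ _ _ => Finset.prod_nonneg fun _ _ => by positivity
    _ = ∏ j, ∑ i : Fin n, (((i : ℕ) : ℝ) + 1) ^ (-(b j)) := by
        rw [Finset.prod_univ_sum, Fintype.piFinset_univ]
    _ = ∏ j, truncatedZeta (b j) n := by
        refine Finset.prod_congr rfl fun j _ => ?_
        exact Fin.sum_univ_eq_sum_range (fun i : ℕ => ((i : ℝ) + 1) ^ (-(b j))) n

lemma rpow_mul_rpow_le_of_le {x y : ℝ} (hx : 0 < x) (hxy : x ≤ y) {a b t : ℝ} (ht : 0 ≤ t) :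
    x ^ (-a) * y ^ (-b) ≤ x ^ (-(a + t)) * y ^ (-(b - t)) := by
  have hy := hx.trans_le hxy
  have h : x ^ t ≤ y ^ t := Real.rpow_le_rpow hx.le hxy ht
  rw [show -a = -(a + t) + t by ring, show -(b - t) = -b + t by ring,
    Real.rpow_add hx, Real.rpow_add hy]
  calc x ^ (-(a + t)) * x ^ t * y ^ (-b) = x ^ (-(a + t)) * y ^ (-b) * x ^ t := by ring
    _ ≤ x ^ (-(a + t)) * y ^ (-b) * y ^ t := by gcongr
    _ = _ := by ring

lemma Fsum_three_le_mul_truncatedZeta {a b c t : ℝ} (ht : 0 ≤ t) (ha : 1 < a + t)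
    (hb : 1 < b - t) :
    ∃ C : ℝ, 0 < C ∧ ∀ n, Fsum 3 ![a, b, c] n ≤ C * truncatedZeta c n := by
  obtain ⟨A, hA0, hA⟩ := truncatedZeta_bounded ha
  obtain ⟨B, hB0, hB⟩ := truncatedZeta_bounded hb
  refine ⟨A * B, by positivity, fun n => ?_⟩
  have h := Fsum_le_prod_truncatedZeta ![a, b, c] ![a + t, b - t, c] n fun f hf => by
    simp only [Fin.prod_univ_three, Matrix.cons_val]
    have h01 : f 0 < f 1 := hf (by decide)
    have hle : ((f 0 : ℕ) : ℝ) + 1 ≤ ((f 1 : ℕ) : ℝ) + 1 := by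
      have : ((f 0 : ℕ) : ℝ) ≤ ((f 1 : ℕ) : ℝ) := by exact_mod_cast h01.le
      linarith
    exact mul_le_mul_of_nonneg_right (rpow_mul_rpow_le_of_le (by positivity) hle ht)
      (by positivity)
  simp only [Fin.prod_univ_three, Matrix.cons_val] at h
  refine h.trans (mul_le_mul_of_nonneg_right ?_ (truncatedZeta_nonneg _ _))
  exact mul_le_mul (hA n) (hB n) (truncatedZeta_nonneg _ _) hA0.le

/-- Keeping only the tuples `(1, 2, k)`. -/
lemma sum_le_Fsum_three (a b c : ℝ) (m : ℕ) :
    2 ^ (-b) * ∑ k ∈ Finset.range m, ((k : ℝ) + 3) ^ (-c) ≤ Fsum 3 ![a, b, c] (m + 2) := by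
  let e : Fin m → (Fin 3 → Fin (m + 2)) := fun k => ![0, 1, k.succ.succ]
  have he : Function.Injective e := fun x y h => by
    simpa [e] using congrFun h 2
  have hmono (k : Fin m) : StrictMono (e k) := by
    refine Fin.strictMono_iff_lt_succ.2 fun i => ?_
    fin_cases i <;> simp [e, Fin.lt_def]
  have hsub : Finset.univ.image e ⊆
      Finset.univ.filter (fun f : Fin 3 → Fin (m + 2) => StrictMono f) := by
    intro f hf
    obtain ⟨k, -, rfl⟩ := Finset.mem_image.1 hf
    simpa using hmono k
  refine le_trans (le_of_eq ?_) (Finset.sum_le_sum_of_subset_of_nonneg hsub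
    fun _ _ _ => Finset.prod_nonneg fun _ _ => by positivity)
  rw [Finset.sum_image he.injOn, Finset.mul_sum,
    ← Fin.sum_univ_eq_sum_range (fun k : ℕ => 2 ^ (-b) * ((k : ℝ) + 3) ^ (-c))]
  refine Finset.sum_congr rfl fun k _ => ?_
  simp only [Fin.prod_univ_three, e, Matrix.cons_val]
  norm_num [add_assoc]

lemma mul_truncatedZeta_le_Fsum_three (a b : ℝ) {c : ℝ} (hc : 0 ≤ c) :
    ∃ A : ℝ, 0 < A ∧ ∀ n, 3 ≤ n → A * truncatedZeta c n ≤ Fsum 3 ![a, b, c] n := by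
  refine ⟨2 ^ (-b) * (3 ^ (-c) / 3), by positivity, fun n hn => ?_⟩
  obtain ⟨m, rfl⟩ := Nat.exists_eq_add_of_le' (show 2 ≤ n by omega)
  refine le_trans ?_ (sum_le_Fsum_three a b c m)
  rw [mul_assoc]
  refine mul_le_mul_of_nonneg_left ?_ (by positivity)
  calc (3 : ℝ) ^ (-c) / 3 * truncatedZeta c (m + 2)
      ≤ 3 ^ (-c) / 3 * (3 * truncatedZeta c m) :=
        mul_le_mul_of_nonneg_left (truncatedZeta_add_two_le hc (by omega)) (by positivity)
    _ = ∑ k ∈ Finset.range m, (3 : ℝ) ^ (-c) * ((k : ℝ) + 1) ^ (-c) := by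
        rw [truncatedZeta, ← Finset.mul_sum]
        ring
    _ ≤ _ := by
        refine Finset.sum_le_sum fun k _ => ?_
        rw [← Real.mul_rpow (by norm_num) (by positivity)]
        refine Real.rpow_le_rpow_of_nonpos (by positivity) ?_ (by linarith)
        linarith [k.cast_nonneg (α := ℝ)]

/-- `F₃(3-3β, 1+β, 2β; n)` has the same order as `∑_{k=1}^n k^{-2β}`. -/
lemma Fsum_wedge_comparable (β : ℝ) (hβ : β ∈ Set.Ioo (0 : ℝ) 1) :
    ∃ A B : ℝ, 0 < A ∧ 0 < B ∧ ∀ n, 3 ≤ n →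
      A * truncatedZeta (2 * β) n ≤ Fsum 3 ![3 - 3 * β, 1 + β, 2 * β] n ∧
      Fsum 3 ![3 - 3 * β, 1 + β, 2 * β] n ≤ B * truncatedZeta (2 * β) n := by
  obtain ⟨h0, h1⟩ := hβ
  obtain ⟨A, hA, hA'⟩ :=
    mul_truncatedZeta_le_Fsum_three (3 - 3 * β) (1 + β) (c := 2 * β) (by linarith)
  have hub : ∃ B : ℝ, 0 < B ∧ ∀ n,
      Fsum 3 ![3 - 3 * β, 1 + β, 2 * β] n ≤ B * truncatedZeta (2 * β) n := by
    rcases le_or_gt (1 / 2) β with h | h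
    · exact Fsum_three_le_mul_truncatedZeta (t := 2 * β - 1) (by linarith) (by linarith)
        (by linarith)
    · exact Fsum_three_le_mul_truncatedZeta (t := 0) le_rfl (by linarith) (by linarith)
  obtain ⟨B, hB, hB'⟩ := hub
  exact ⟨A, B, hA, hB, fun n hn => ⟨hA' n hn, hB' n⟩⟩

lemma exists_comparison_constants {F T g : ℕ → ℝ} {A B c C : ℝ} (hA : 0 < A) (hB : 0 < B)
    (hc : 0 < c) (hF : ∀ n, 3 ≤ n → A * T n ≤ F n ∧ F n ≤ B * T n)
    (hT : ∀ n, 3 ≤ n → c * g n ≤ T n ∧ T n ≤ C * g n) (hg : ∀ n, 3 ≤ n → 0 ≤ g n) :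
    ∃ c' C' : ℝ, 0 < c' ∧ c' ≤ C' ∧ ∀ n, 3 ≤ n → c' * g n ≤ F n ∧ F n ≤ C' * g n := by
  refine ⟨A * c, max (A * c) (B * C), by positivity, le_max_left _ _, fun n hn => ⟨?_, ?_⟩⟩
  · rw [mul_assoc]
    exact (mul_le_mul_of_nonneg_left (hT n hn).1 hA.le).trans (hF n hn).1
  · calc F n ≤ B * T n := (hF n hn).2
      _ ≤ B * (C * g n) := mul_le_mul_of_nonneg_left (hT n hn).2 hB.le
      _ = B * C * g n := by ring
      _ ≤ _ := mul_le_mul_of_nonneg_right (le_max_right _ _) (hg n hn)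

/-- Order of `F₃(3-3β, 1+β, 2β; n)`: constant for `β > 1/2`, `log n` for `β = 1/2`,
and `n^{1-2β}` for `β < 1/2`. -/
theorem F3_wedge_asymptotics (β : ℝ) (hβ : β ∈ Set.Ioo (0 : ℝ) 1) :
    ∃ c C : ℝ, 0 < c ∧ c ≤ C ∧ ∀ n : ℕ, 3 ≤ n →
      (1 / 2 < β →
        c ≤ Fsum 3 ![3 - 3 * β, 1 + β, 2 * β] n ∧
        Fsum 3 ![3 - 3 * β, 1 + β, 2 * β] n ≤ C) ∧
      (β = 1 / 2 →
        c * Real.log n ≤ Fsum 3 ![3 - 3 * β, 1 + β, 2 * β] n ∧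
        Fsum 3 ![3 - 3 * β, 1 + β, 2 * β] n ≤ C * Real.log n) ∧
      (β < 1 / 2 →
        c * (n : ℝ) ^ (1 - 2 * β) ≤ Fsum 3 ![3 - 3 * β, 1 + β, 2 * β] n ∧
        Fsum 3 ![3 - 3 * β, 1 + β, 2 * β] n ≤ C * (n : ℝ) ^ (1 - 2 * β)) := by
  obtain ⟨A, B, hA, hB, hF⟩ := Fsum_wedge_comparable β hβ
  obtain ⟨h0, -⟩ := hβ
  rcases lt_trichotomy (1 / 2) β with h | h | h
  · obtain ⟨K, -, hK⟩ := truncatedZeta_bounded (s := 2 * β) (by linarith)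
    obtain ⟨c, C, hc, hcC, H⟩ := exists_comparison_constants (g := fun _ => 1) (C := K) hA hB
      one_pos hF
      (fun n hn => ⟨by simpa using one_le_truncatedZeta _ (by omega), by simpa using hK n⟩)
      (fun _ _ => zero_le_one)
    refine ⟨c, C, hc, hcC, fun n hn => ⟨fun _ => by simpa using H n hn, fun h' => ?_, fun h' => ?_⟩⟩
    · linarith
    · linarith
  · obtain ⟨c, C, hc, hcC, H⟩ := exists_comparison_constants (g := fun n => Real.log n) (C := 2)
      hA hB one_pos hF
      (fun n hn => by
        rw [← h, show (2 : ℝ) * (1 / 2) = 1 by norm_num, truncatedZeta_one_eq_harmonic]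
        have hlog := one_le_log_of_three_le hn
        have hup := harmonic_le_one_add_log n
        have hlo := log_add_one_le_harmonic n
        have hmono : Real.log n ≤ Real.log ((n + 1 : ℕ) : ℝ) :=
          Real.log_le_log (by positivity) (by push_cast; linarith)
        exact ⟨by linarith, by linarith⟩)
      (fun n hn => zero_le_one.trans (one_le_log_of_three_le hn))
    refine ⟨c, C, hc, hcC, fun n hn => ⟨fun h' => ?_, fun _ => H n hn, fun h' => ?_⟩⟩
    · linarith
    · linarith
  · obtain ⟨c, C, hc, hcC, H⟩ := exists_comparison_constants
      (g := fun n => (n : ℝ) ^ (1 - 2 * β)) (C := (1 - 2 * β)⁻¹) hA hB one_pos hF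
      (fun n hn => ⟨by
        simpa using rpow_le_truncatedZeta (s := 2 * β) (by linarith) (n := n) (by omega),
        truncatedZeta_le_rpow (by linarith) (by linarith) n⟩)
      (fun n _ => by positivity)
    refine ⟨c, C, hc, hcC, fun n hn => ⟨fun h' => ?_, fun h' => ?_, fun _ => H n hn⟩⟩
    · linarith
    · linarith
end

section
/- Let β ∈ (0, 1/2), and let a ≥ 1 and ℓ ≥ 2a be integers with ℓ ≥ 3. Consider the exponent vector whose first a entries equal 2−2β, whose next ℓ−2a entries equal 1, and whose last a entries equal 2β. Then there exist constants 0 < c ≤ C, depending only on ℓ, a and β, such that for all integers n ≥ 2ℓ: c · n^{(1−2β)a} · (log n)^{ℓ−2a} ≤ F_ℓ(2−2β,…,2−2β, 1,…,1, 2β,…,2β; n) ≤ C · n^{(1−2β)a} · (log n)^{ℓ−2a}. -/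
open Real
open scoped Classical

open Filter Asymptotics Finset

theorem Fsum_eq_sum_piFinset (k : ℕ) (a : Fin k → ℝ) (n : ℕ) :
    Fsum k a n = ∑ f ∈ (Fintype.piFinset fun _ : Fin k => range n).filter
      (fun f : Fin k → ℕ => StrictMono f), ∏ j, ((f j : ℝ) + 1) ^ (-(a j)) := by
  unfold Fsum
  refine sum_bij (fun f _ j => (f j : ℕ)) ?_ ?_ ?_ ?_
  · intro f hf
    simp only [mem_filter, Finset.mem_univ, true_and] at hf
    simp only [mem_filter, Fintype.mem_piFinset, mem_range]
    exact ⟨fun j => (f j).2, fun i j hij => hf hij⟩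
  · intro f _ g _ h
    funext j
    exact Fin.ext (congrFun h j)
  · intro g hg
    simp only [mem_filter, Fintype.mem_piFinset, mem_range] at hg
    refine ⟨fun j => ⟨g j, hg.1 j⟩, ?_, rfl⟩
    simp only [mem_filter, Finset.mem_univ, true_and]
    exact fun i j hij => hg.2 hij
  · intro f _
    rfl

/-- Splitting the sum according to its largest index. -/
theorem Fsum_succ (k : ℕ) (a : Fin (k + 1) → ℝ) (n : ℕ) :
    Fsum (k + 1) a n =
      ∑ i ∈ range n, Fsum k (fun j => a j.castSucc) i * ((i : ℝ) + 1) ^ (-(a (Fin.last k))) := by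
  simp only [Fsum_eq_sum_piFinset, sum_mul]
  rw [sum_sigma']
  refine sum_bij' (fun f _ => ⟨f (Fin.last k), fun j => f j.castSucc⟩)
    (fun p _ => Fin.snoc (α := fun _ => ℕ) p.2 p.1) ?_ ?_ ?_ ?_ ?_
  · intro f hf
    simp only [mem_filter, Fintype.mem_piFinset, mem_range, mem_sigma] at hf ⊢
    exact ⟨hf.1 _, fun j => hf.2 (Fin.castSucc_lt_last j),
      fun i j hij => hf.2 (Fin.castSucc_lt_castSucc_iff.2 hij)⟩
  · rintro ⟨i, g⟩ hp
    simp only [mem_filter, Fintype.mem_piFinset, mem_range, mem_sigma] at hp ⊢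
    obtain ⟨hi, hg, hmono⟩ := hp
    constructor
    · intro j
      refine Fin.lastCases ?_ (fun j => ?_) j
      · simpa using hi
      · simpa using (hg j).trans hi
    · intro x y
      refine Fin.lastCases ?_ (fun y => ?_) y
      · refine Fin.lastCases ?_ (fun x => ?_) x
        · intro h
          exact absurd h (lt_irrefl _)
        · intro _
          simpa using hg x
      · refine Fin.lastCases ?_ (fun x => ?_) x
        · intro h
          exact absurd h (Fin.castSucc_lt_last y).not_gt
        · intro h
          simpa using hmono (Fin.castSucc_lt_castSucc_iff.1 h)
  · intro f _
    exact Fin.snoc_init_self f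
  · rintro ⟨i, g⟩ _
    simp
  · intro f _
    rw [Fin.prod_univ_castSucc]

theorem Fsum_nonneg (k : ℕ) (a : Fin k → ℝ) (n : ℕ) : 0 ≤ Fsum k a n :=
  sum_nonneg fun _ _ => prod_nonneg fun _ _ => by positivity

theorem Fsum_pos {k : ℕ} (a : Fin k → ℝ) {n : ℕ} (h : k ≤ n) : 0 < Fsum k a n := by
  refine sum_pos (fun _ _ => prod_pos fun _ _ => by positivity) ⟨Fin.castLE h, ?_⟩
  simp only [mem_filter, Finset.mem_univ, true_and]
  exact Fin.strictMono_castLE h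

theorem Fsum_mono (k : ℕ) (a : Fin k → ℝ) : Monotone (Fsum k a) := by
  intro m n hmn
  rw [Fsum_eq_sum_piFinset, Fsum_eq_sum_piFinset]
  refine sum_le_sum_of_subset_of_nonneg ?_ fun _ _ _ => prod_nonneg fun _ _ => by positivity
  intro f hf
  simp only [mem_filter, Fintype.mem_piFinset, mem_range] at hf ⊢
  exact ⟨fun j => (hf.1 j).trans_le hmn, hf.2⟩

theorem Fsum_succ_le (k : ℕ) (e : ℕ → ℝ) (n : ℕ) :
    Fsum (k + 1) (fun i => e i) n ≤
      Fsum k (fun i => e i) n * ∑ i ∈ range n, ((i : ℝ) + 1) ^ (-(e k)) := by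
  rw [Fsum_succ, mul_sum]
  refine sum_le_sum fun i hi => ?_
  exact mul_le_mul_of_nonneg_right (Fsum_mono k _ (mem_range.1 hi).le) (by positivity)

theorem le_Fsum_succ (k : ℕ) (e : ℕ → ℝ) {m n : ℕ} :
    Fsum k (fun i => e i) m * ∑ i ∈ Ico m n, ((i : ℝ) + 1) ^ (-(e k)) ≤
      Fsum (k + 1) (fun i => e i) n := by
  rw [Fsum_succ, mul_sum]
  calc _ ≤ ∑ i ∈ Ico m n, Fsum k (fun j => e j) i * ((i : ℝ) + 1) ^ (-(e k)) :=
        sum_le_sum fun i hi => mul_le_mul_of_nonneg_right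
          (Fsum_mono k _ (mem_Ico.1 hi).1) (by positivity)
    _ ≤ _ := by
        refine sum_le_sum_of_subset_of_nonneg ?_ fun i _ _ =>
          mul_nonneg (Fsum_nonneg _ _ _) (by positivity)
        intro i hi
        exact mem_range.2 (mem_Ico.1 hi).2

theorem Fsum_succ_isBigO {k : ℕ} {e : ℕ → ℝ} {g h : ℕ → ℝ}
    (hg : Fsum k (fun i => e i) =O[atTop] g)
    (hh : (fun n => ∑ i ∈ range n, ((i : ℝ) + 1) ^ (-(e k))) =O[atTop] h) :
    Fsum (k + 1) (fun i => e i) =O[atTop] fun n => g n * h n := by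
  refine IsBigO.trans (.of_norm_le fun n => ?_) (hg.mul hh)
  rw [Real.norm_of_nonneg (Fsum_nonneg _ _ _)]
  exact Fsum_succ_le k e n

theorem isBigO_Fsum_succ {k : ℕ} {e : ℕ → ℝ} {g h : ℕ → ℝ} {m : ℕ → ℕ}
    (hm : Tendsto m atTop atTop) (hg : g =O[atTop] Fsum k (fun i => e i))
    (hgm : g =O[atTop] (g ∘ m))
    (hh : h =O[atTop] fun n => ∑ i ∈ Ico (m n) n, ((i : ℝ) + 1) ^ (-(e k))) :
    (fun n => g n * h n) =O[atTop] Fsum (k + 1) (fun i => e i) := by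
  refine ((hgm.trans (hg.comp_tendsto hm)).mul hh).trans (.of_norm_le fun n => ?_)
  rw [Function.comp_apply, Real.norm_of_nonneg (mul_nonneg (Fsum_nonneg _ _ _)
    (sum_nonneg fun _ _ => by positivity))]
  exact le_Fsum_succ k e

theorem sum_rpow_neg_isBigO_one {s : ℝ} (hs : 1 < s) :
    (fun n => ∑ i ∈ range n, ((i : ℝ) + 1) ^ (-s)) =O[atTop] fun _ : ℕ => (1 : ℝ) := by
  have hsum : Summable fun i : ℕ => ((i : ℝ) + 1) ^ (-s) := by
    have := (summable_nat_add_iff 1).2 (Real.summable_nat_rpow.2 (neg_lt_neg hs))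
    simpa using this
  exact hsum.hasSum.tendsto_sum_nat.isBigO_one ℝ

theorem sum_inv_isBigO_log :
    (fun n => ∑ i ∈ range n, ((i : ℝ) + 1) ^ (-(1 : ℝ))) =O[atTop]
      fun n : ℕ => Real.log n := by
  refine IsBigO.of_bound 2 ?_
  filter_upwards [eventually_ge_atTop 3] with n hn
  have hlog : 1 ≤ Real.log n := by
    rw [Real.le_log_iff_exp_le (by positivity)]
    exact Real.exp_one_lt_d9.le.trans ((by norm_num : (2.7182818286 : ℝ) ≤ 3).trans
      (by exact_mod_cast hn))
  have h := harmonic_le_one_add_log n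
  rw [Real.norm_of_nonneg (sum_nonneg fun _ _ => by positivity),
    Real.norm_of_nonneg (by linarith)]
  have heq : ∑ i ∈ range n, ((i : ℝ) + 1) ^ (-(1 : ℝ)) = (harmonic n : ℝ) := by
    simp [harmonic, Real.rpow_neg_one]
  rw [heq]
  linarith

theorem rpow_neg_le_sub {s : ℝ} (h0 : 0 < s) (h1 : s < 1) (i : ℕ) :
    (1 - s) * ((i : ℝ) + 1) ^ (-s) ≤ ((i : ℝ) + 1) ^ (1 - s) - (i : ℝ) ^ (1 - s) := by
  have hi : (0 : ℝ) < (i : ℝ) + 1 := by positivity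
  have hle : ((i : ℝ) + 1)⁻¹ ≤ 1 := inv_le_one_of_one_le₀ (by linarith [i.cast_nonneg (α := ℝ)])
  have hb := rpow_one_add_le_one_add_mul_self (s := -((i : ℝ) + 1)⁻¹) (p := 1 - s)
    (by linarith) (by linarith) (by linarith)
  have hfac : (i : ℝ) ^ (1 - s) = ((i : ℝ) + 1) ^ (1 - s) * (1 + -((i : ℝ) + 1)⁻¹) ^ (1 - s) := by
    rw [← Real.mul_rpow hi.le (by linarith)]
    congr 1
    field_simp
    ring
  have hneg : ((i : ℝ) + 1) ^ (-s) = ((i : ℝ) + 1) ^ (1 - s) * ((i : ℝ) + 1)⁻¹ := by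
    rw [← Real.rpow_neg_one, ← Real.rpow_add hi]
    congr 1
    ring
  rw [hfac, hneg]
  have := mul_le_mul_of_nonneg_left hb (Real.rpow_nonneg hi.le (1 - s))
  linarith

theorem sum_rpow_neg_isBigO_rpow {s : ℝ} (h0 : 0 < s) (h1 : s < 1) :
    (fun n => ∑ i ∈ range n, ((i : ℝ) + 1) ^ (-s)) =O[atTop]
      fun n : ℕ => (n : ℝ) ^ (1 - s) := by
  refine IsBigO.of_bound (1 - s)⁻¹ (.of_forall fun n => ?_)
  rw [Real.norm_of_nonneg (sum_nonneg fun _ _ => by positivity),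
    Real.norm_of_nonneg (by positivity), inv_mul_eq_div, le_div_iff₀' (by linarith), mul_sum]
  refine (sum_le_sum fun i _ => rpow_neg_le_sub h0 h1 i).trans ?_
  have := sum_range_sub (fun i : ℕ => (i : ℝ) ^ (1 - s)) n
  push_cast at this
  rw [this, Real.zero_rpow (by linarith), sub_zero]

theorem log_sub_log_le_sum_Ico {m n : ℕ} (h : m ≤ n) :
    Real.log (n + 1) - Real.log (m + 1) ≤ ∑ i ∈ Ico m n, ((i : ℝ) + 1) ^ (-(1 : ℝ)) := by
  have htel := sum_Ico_sub (fun i : ℕ => Real.log ((i : ℝ) + 1)) h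
  rw [← htel]
  refine sum_le_sum fun i _ => ?_
  have hi : (0 : ℝ) < (i : ℝ) + 1 := by positivity
  rw [← Real.log_div (by positivity) hi.ne', Real.rpow_neg_one]
  refine (Real.log_le_sub_one_of_pos (by positivity)).trans (le_of_eq ?_)
  push_cast
  field_simp
  ring

theorem log_isBigO_sum_Ico_sqrt :
    (fun n : ℕ => Real.log n) =O[atTop]
      fun n => ∑ i ∈ Ico (Nat.sqrt n) n, ((i : ℝ) + 1) ^ (-(1 : ℝ)) := by
  refine IsBigO.of_bound 4 ?_
  filter_upwards [eventually_ge_atTop 16] with n hn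
  have hn' : (16 : ℝ) ≤ n := by exact_mod_cast hn
  rw [Real.norm_of_nonneg (Real.log_natCast_nonneg n),
    Real.norm_of_nonneg (sum_nonneg fun _ _ => by positivity)]
  have h1 := log_sub_log_le_sum_Ico (Nat.sqrt_le_self n)
  have h2 : Real.log n ≤ Real.log (n + 1) := Real.log_le_log (by linarith) (by linarith)
  have hm1 : 1 ≤ Nat.sqrt n := Nat.le_sqrt.2 (by omega)
  have hsq : ((Nat.sqrt n + 1 : ℕ) : ℝ) ^ 2 ≤ 4 * n := by
    have := Nat.sqrt_le' n
    exact_mod_cast (by nlinarith : (Nat.sqrt n + 1) ^ 2 ≤ 4 * n)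
  have h3 : 2 * Real.log ((Nat.sqrt n : ℝ) + 1) ≤ Real.log 4 + Real.log n := by
    rw [← Real.log_mul (by norm_num) (by linarith)]
    have := Real.log_le_log (by positivity) hsq
    rw [Real.log_pow] at this
    exact_mod_cast this
  have h4 : 2 * Real.log 4 ≤ Real.log n := by
    have := Real.log_le_log (by norm_num) hn'
    rw [show (16 : ℝ) = 4 ^ 2 by norm_num, Real.log_pow] at this
    exact_mod_cast this
  linarith

theorem tendsto_natSqrt_atTop : Tendsto Nat.sqrt atTop atTop :=
  tendsto_atTop.2 fun b => by
    filter_upwards [eventually_ge_atTop (b * b)] with n hn using Nat.le_sqrt.2 hn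

theorem log_isBigO_log_of_le_pow {m : ℕ → ℕ} (h : ∀ᶠ n in atTop, n ≤ m n ^ 4) :
    (fun n : ℕ => Real.log n) =O[atTop] fun n => Real.log (m n) := by
  refine IsBigO.of_bound 4 ?_
  filter_upwards [h, eventually_ge_atTop 1] with n hn h1
  rw [Real.norm_of_nonneg (Real.log_natCast_nonneg n),
    Real.norm_of_nonneg (Real.log_natCast_nonneg _)]
  have := Real.log_le_log (by positivity) (by exact_mod_cast hn : (n : ℝ) ≤ (m n : ℝ) ^ 4)
  rw [Real.log_pow] at this
  exact_mod_cast this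

theorem rpow_isBigO_sum_Ico_half {s : ℝ} (h0 : 0 < s) :
    (fun n : ℕ => (n : ℝ) ^ (1 - s)) =O[atTop]
      fun n => ∑ i ∈ Ico (n / 2) n, ((i : ℝ) + 1) ^ (-s) := by
  refine IsBigO.of_bound 2 ?_
  filter_upwards [eventually_ge_atTop 1] with n hn
  have hn' : (0 : ℝ) < n := by exact_mod_cast hn
  rw [Real.norm_of_nonneg (by positivity),
    Real.norm_of_nonneg (sum_nonneg fun _ _ => by positivity)]
  have hle : ∀ i ∈ Ico (n / 2) n, (n : ℝ) ^ (-s) ≤ ((i : ℝ) + 1) ^ (-s) := fun i hi =>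
    Real.rpow_le_rpow_of_nonpos (by positivity) (by exact_mod_cast (mem_Ico.1 hi).2)
      (by linarith)
  have hcard := card_nsmul_le_sum _ _ _ hle
  rw [Nat.card_Ico, nsmul_eq_mul] at hcard
  have hhalf : (n : ℝ) ≤ 2 * ((n - n / 2 : ℕ) : ℝ) := by
    exact_mod_cast (by omega : n ≤ 2 * (n - n / 2))
  have hpow : (n : ℝ) ^ (1 - s) = n * (n : ℝ) ^ (-s) := by
    rw [sub_eq_add_neg, Real.rpow_add hn', Real.rpow_one]
  rw [hpow]
  have := mul_le_mul_of_nonneg_right hhalf (Real.rpow_nonneg hn'.le (-s))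
  linarith

theorem natCast_isBigO_half :
    (fun n : ℕ => (n : ℝ)) =O[atTop] fun n : ℕ => ((n / 2 : ℕ) : ℝ) := by
  refine IsBigO.of_bound 4 ?_
  filter_upwards [eventually_ge_atTop 2] with n hn
  rw [Real.norm_of_nonneg (by positivity), Real.norm_of_nonneg (by positivity)]
  exact_mod_cast (by omega : n ≤ 4 * (n / 2))

theorem Fsum_isTheta_one {e : ℕ → ℝ} (k : ℕ) (he : ∀ i < k, 1 < e i) :
    Fsum k (fun i => e i) =Θ[atTop] fun _ : ℕ => (1 : ℝ) := by
  constructor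
  · induction k with
    | zero => exact .of_norm_le fun n => by simp [Fsum, Subsingleton.strictMono]
    | succ k ih =>
      simpa using Fsum_succ_isBigO (ih fun i hi => he i (by omega))
        (sum_rpow_neg_isBigO_one (he k (by omega)))
  · refine IsBigO.of_bound (Fsum k (fun i => e i) k)⁻¹ ?_
    filter_upwards [eventually_ge_atTop k] with n hn
    rw [Real.norm_of_nonneg (Fsum_nonneg _ _ _), norm_one, inv_mul_eq_div,
      one_le_div (Fsum_pos _ le_rfl)]
    exact Fsum_mono k _ hn

theorem Fsum_succ_isTheta_log {e : ℕ → ℝ} {k q : ℕ} (he : e k = 1)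
    (h : Fsum k (fun i => e i) =Θ[atTop] fun n : ℕ => Real.log n ^ q) :
    Fsum (k + 1) (fun i => e i) =Θ[atTop] fun n : ℕ => Real.log n ^ (q + 1) := by
  simp only [pow_succ]
  refine ⟨Fsum_succ_isBigO h.1 (by simpa only [he] using sum_inv_isBigO_log),
    isBigO_Fsum_succ tendsto_natSqrt_atTop h.2 ?_ (by simpa only [he] using
      log_isBigO_sum_Ico_sqrt)⟩
  refine (log_isBigO_log_of_le_pow ?_).pow q
  filter_upwards [eventually_ge_atTop 4] with n hn
  have h2 : 2 ≤ Nat.sqrt n := Nat.le_sqrt.2 (by omega)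
  have h3 := Nat.lt_succ_sqrt' n
  have h4 : Nat.sqrt n + 1 ≤ Nat.sqrt n ^ 2 := by nlinarith
  calc n ≤ (Nat.sqrt n + 1) ^ 2 := h3.le
    _ ≤ (Nat.sqrt n ^ 2) ^ 2 := Nat.pow_le_pow_left h4 2
    _ = Nat.sqrt n ^ 4 := by ring

theorem Fsum_succ_isTheta_rpow {e : ℕ → ℝ} {k q : ℕ} {p : ℝ} (hp : 0 ≤ p)
    (h0 : 0 < e k) (h1 : e k < 1)
    (h : Fsum k (fun i => e i) =Θ[atTop] fun n : ℕ => (n : ℝ) ^ p * Real.log n ^ q) :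
    Fsum (k + 1) (fun i => e i) =Θ[atTop]
      fun n : ℕ => (n : ℝ) ^ (p + (1 - e k)) * Real.log n ^ q := by
  have heq : (fun n : ℕ => (n : ℝ) ^ (p + (1 - e k)) * Real.log n ^ q) =
      fun n : ℕ => ((n : ℝ) ^ p * Real.log n ^ q) * (n : ℝ) ^ (1 - e k) := by
    funext n
    rw [Real.rpow_add_of_nonneg n.cast_nonneg hp (by linarith)]
    ring
  rw [heq]
  refine ⟨Fsum_succ_isBigO h.1 (sum_rpow_neg_isBigO_rpow h0 h1),
    isBigO_Fsum_succ (Nat.tendsto_div_const_atTop two_ne_zero) h.2 ?_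
      (rpow_isBigO_sum_Ico_half h0)⟩
  refine (natCast_isBigO_half.rpow hp (.of_forall fun n => by positivity)).mul
    ((log_isBigO_log_of_le_pow ?_).pow q)
  filter_upwards [eventually_ge_atTop 4] with n hn
  have h2 : 2 ≤ n / 2 := by omega
  have h3 : 4 ≤ (n / 2) ^ 2 := by nlinarith
  calc n ≤ 4 * (n / 2) := by omega
    _ ≤ (n / 2) ^ 2 * (n / 2) ^ 2 := Nat.mul_le_mul h3 (by nlinarith)
    _ = (n / 2) ^ 4 := by ring

theorem Fsum_isTheta {e : ℕ → ℝ} {s : ℝ} (h0 : 0 < s) (h1 : s < 1) (k q r : ℕ)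
    (hfst : ∀ i < k, 1 < e i) (hmid : ∀ i < q, e (k + i) = 1)
    (hlast : ∀ i < r, e (k + q + i) = s) :
    Fsum (k + q + r) (fun i => e i) =Θ[atTop]
      fun n : ℕ => (n : ℝ) ^ ((1 - s) * r) * Real.log n ^ q := by
  have hlog : Fsum (k + q) (fun i => e i) =Θ[atTop] fun n : ℕ => Real.log n ^ q := by
    clear hlast
    induction q with
    | zero => simpa using Fsum_isTheta_one k hfst
    | succ q ih =>
      exact Fsum_succ_isTheta_log (hmid q (by omega)) (ih fun i hi => hmid i (by omega))
  induction r with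
  | zero => simpa using hlog
  | succ r ih =>
    have hs := hlast r (by omega)
    have := Fsum_succ_isTheta_rpow (mul_nonneg (by linarith) r.cast_nonneg)
      (hs ▸ h0) (hs ▸ h1) (ih fun i hi => hlast i (by omega))
    rw [hs, show (1 - s) * (r : ℝ) + (1 - s) = (1 - s) * (r + 1 : ℕ) by push_cast; ring] at this
    exact this

/-- Order of the `ℓ`-cycle embedding sum: for the exponent vector with first `a` entries
`2-2β`, next `ℓ-2a` entries `1` and last `a` entries `2β`,
`F_ℓ(⋯; n) ≍ n^{(1-2β)a} (log n)^{ℓ-2a}` when `β ∈ (0, 1/2)`. -/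
theorem Fsum_cycle_embedding_asymptotics (β : ℝ) (hβ : β ∈ Set.Ioo (0 : ℝ) (1 / 2))
    (a ℓ : ℕ) (ha : 1 ≤ a) (hℓa : 2 * a ≤ ℓ) (hℓ : 3 ≤ ℓ) :
    ∃ c C : ℝ, 0 < c ∧ c ≤ C ∧ ∀ n : ℕ, 2 * ℓ ≤ n →
      c * (n : ℝ) ^ ((1 - 2 * β) * a) * (Real.log n) ^ (ℓ - 2 * a) ≤
        Fsum ℓ (fun i => if (i : ℕ) < a then 2 - 2 * β
          else if (i : ℕ) < ℓ - a then 1 else 2 * β) n ∧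
      Fsum ℓ (fun i => if (i : ℕ) < a then 2 - 2 * β
          else if (i : ℕ) < ℓ - a then 1 else 2 * β) n ≤
        C * (n : ℝ) ^ ((1 - 2 * β) * a) * (Real.log n) ^ (ℓ - 2 * a) := by
  obtain ⟨hβ0, hβ1⟩ := hβ
  set e : ℕ → ℝ := fun i => if i < a then 2 - 2 * β else if i < ℓ - a then 1 else 2 * β with he
  have hθ := Fsum_isTheta (e := e) (s := 2 * β) (by linarith) (by linarith) a (ℓ - 2 * a) a
    (fun i hi => by simp only [he, if_pos hi]; linarith)
    (fun i hi => by simp only [he]; rw [if_neg (by omega), if_pos (by omega)])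
    (fun i hi => by simp only [he]; rw [if_neg (by omega), if_neg (by omega)])
  rw [show a + (ℓ - 2 * a) + a = ℓ by omega] at hθ
  obtain ⟨C, hC, hupper⟩ := bound_of_isBigO_nat_atTop hθ.1
  obtain ⟨D, hD, hlower⟩ := bound_of_isBigO_nat_atTop hθ.2
  have key : ∀ n : ℕ, 2 * ℓ ≤ n →
      D⁻¹ * ((n : ℝ) ^ ((1 - 2 * β) * a) * Real.log n ^ (ℓ - 2 * a)) ≤
        Fsum ℓ (fun i => e i) n ∧
      Fsum ℓ (fun i => e i) n ≤
        C * ((n : ℝ) ^ ((1 - 2 * β) * a) * Real.log n ^ (ℓ - 2 * a)) := by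
    intro n hn
    have hn1 : (1 : ℝ) < n := by exact_mod_cast (by omega : 1 < n)
    have hlog := Real.log_pos hn1
    have hpos : 0 < (n : ℝ) ^ ((1 - 2 * β) * a) * Real.log n ^ (ℓ - 2 * a) := by positivity
    have hF : 0 < Fsum ℓ (fun i => e i) n := Fsum_pos _ (by omega)
    have hu := hupper hpos.ne'
    have hl := hlower hF.ne'
    rw [Real.norm_of_nonneg hpos.le, Real.norm_of_nonneg hF.le] at hu hl
    exact ⟨(inv_mul_le_iff₀ hD).2 hl, hu⟩
  refine ⟨D⁻¹, max C D⁻¹, inv_pos.2 hD, le_max_right _ _, fun n hn => ?_⟩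
  obtain ⟨hl, hu⟩ := key n hn
  rw [mul_assoc, mul_assoc]
  refine ⟨hl, hu.trans (mul_le_mul_of_nonneg_right (le_max_left _ _) ?_)⟩
  exact mul_nonneg (by positivity) (pow_nonneg (Real.log_natCast_nonneg n) _)
end
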